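/- Let U ⊆ ℝ³ be a contractible open set and let a, b : U → ℝ be smooth functions. Then the pair of equations X²b = (XY + Z)a and Y²a = (YX − Z)b holds on U if and only if there exists a smooth function f : U → ℝ with Xf = a and Yf = b on U (local exactness of the Rumin complex for the Heisenberg distribution in degree one). -/

import Mathlib

/-- Heisenberg operator `X = ∂/∂x` on `ℝ³` with coordinates `(x, y, t)`. -/
noncomputable def opX (f : (Fin 3 → ℝ) → ℝ) : (Fin 3 → ℝ) → ℝ :=
  fun p => fderiv ℝ f p ![1, 0, 0]

/-- Heisenberg operator `Y = ∂/∂t + x ∂/∂y` on `ℝ³`. -/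
noncomputable def opY (f : (Fin 3 → ℝ) → ℝ) : (Fin 3 → ℝ) → ℝ :=
  fun p => fderiv ℝ f p ![0, p 0, 1]

/-- Heisenberg operator `Z = [X, Y] = ∂/∂y` on `ℝ³`. -/
noncomputable def opZ (f : (Fin 3 → ℝ) → ℝ) : (Fin 3 → ℝ) → ℝ :=
  fun p => fderiv ℝ f p ![0, 1, 0]

open Set Filter Topology

/-- On a simply connected, locally path connected space, a family of functions on an open cover
with locally constant differences can be corrected to a global function by locally constant
functions, i.e. the Čech 1-cocycle of differences is a coboundary. -/
theorem exists_sub_locallyConstant_of_simplyConnected {S G : Type*} [TopologicalSpace S]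
    [SimplyConnectedSpace S] [LocallyPathConnectedSpace S] [AddCommGroup G]
    (V : S → Set S) (hV : ∀ i, IsOpen (V i)) (hmem : ∀ x, x ∈ V x) (g : S → S → G)
    (hg : ∀ i j, ∀ x ∈ V i ∩ V j, ∀ᶠ y in 𝓝 x, g i y - g j y = g i x - g j x) :
    ∃ f : S → G, ∀ i, ∀ x ∈ V i, ∀ᶠ y in 𝓝 x, f y - g i y = f x - g i x := by
  let : TopologicalSpace G := ⊥
  have : DiscreteTopology G := ⟨rfl⟩
  let Z : FiberBundleCore S S G :=
    { baseSet := V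
      isOpen_baseSet := hV
      indexAt := id
      mem_baseSet_at := hmem
      coordChange := fun i j x v => v + (g i x - g j x)
      coordChange_self := fun i x _ v => by simp
      continuousOn_coordChange := fun i j => by
        refine continuousOn_snd.add fun p hp => ContinuousAt.continuousWithinAt ?_
        have h : ContinuousAt (fun x => g i x - g j x) p.1 := by
          rw [ContinuousAt, nhds_discrete G, tendsto_pure]
          exact hg i j p.1 hp.1
        exact h.comp continuousAt_fst
      coordChange_comp := fun i j k x _ v => by abel }
  have hcov : IsCoveringMap Z.proj := FiberBundle.isCoveringMap (F := G) (E := Z.Fiber)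
  obtain ⟨x₀⟩ : Nonempty S := inferInstance
  obtain ⟨s, ⟨-, hs⟩, -⟩ := hcov.existsUnique_continuousMap_lifts (ContinuousMap.id S) x₀
    (⟨x₀, (0 : G)⟩ : Z.TotalSpace) rfl
  have hs' : ∀ x, (s x).1 = x := congrFun hs
  let w : Z.TotalSpace → G := fun e => e.2
  refine ⟨fun x => w (s x) + g x x, fun i x hx => ?_⟩
  have htriv : ∀ y, (Z.localTriv i (s y)).2 = w (s y) + g y y - g i y := by
    intro y
    rw [Z.localTriv_apply]
    change w (s y) + (g (s y).1 (s y).1 - g i (s y).1) = _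
    rw [hs' y]
    abel
  have hc : ContinuousAt (fun y => (Z.localTriv i (s y)).2) x := by
    refine continuousAt_snd.comp (((Z.localTriv i).continuousAt ?_).comp s.continuous.continuousAt)
    rw [Z.mem_localTriv_source, hs' x]
    exact hx
  rw [ContinuousAt, nhds_discrete G, tendsto_pure] at hc
  simpa only [htriv] using hc

/-- **Poincaré lemma** for 1-forms on a simply connected open set. -/
theorem IsOpen.exists_forall_hasFDerivAt_of_simplyConnected {E F : Type*}
    [NormedAddCommGroup E] [NormedSpace ℝ E] [NormedAddCommGroup F] [NormedSpace ℝ F]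
    [CompleteSpace F] {U : Set E} (hU : IsOpen U) [SimplyConnectedSpace U] {ω : E → E →L[ℝ] F}
    (hω : DifferentiableOn ℝ ω U)
    (hdω : ∀ p ∈ U, ∀ u v, fderiv ℝ ω p u v = fderiv ℝ ω p v u) :
    ∃ f : E → F, ∀ p ∈ U, HasFDerivAt f (ω p) p := by
  have : LocallyPathConnectedSpace U := hU.locallyPathConnectedSpace
  have hloc : ∀ x : U, ∃ r > 0, Metric.ball (x : E) r ⊆ U ∧
      ∃ f : E → F, ∀ p ∈ Metric.ball (x : E) r, HasFDerivAt f (ω p) p := by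
    intro x
    obtain ⟨r, hr, hrU⟩ := Metric.isOpen_iff.mp hU x x.2
    exact ⟨r, hr, hrU, (convex_ball _ _).exists_forall_hasFDerivAt_of_fderiv_symmetric
      Metric.isOpen_ball (hω.mono hrU) fun p hp => hdω p (hrU hp)⟩
  choose r hr _ g hg using hloc
  obtain ⟨f, hf⟩ := exists_sub_locallyConstant_of_simplyConnected
    (fun i : U => Subtype.val ⁻¹' Metric.ball (i : E) (r i))
    (fun i => Metric.isOpen_ball.preimage continuous_subtype_val)
    (fun i => Metric.mem_ball_self (hr i)) (fun i x => g i x) (by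
      intro i j x hx
      have hopen : IsOpen (Metric.ball (i : E) (r i) ∩ Metric.ball (j : E) (r j)) :=
        Metric.isOpen_ball.inter Metric.isOpen_ball
      have hd : ∀ p ∈ Metric.ball (i : E) (r i) ∩ Metric.ball (j : E) (r j),
          HasFDerivAt (fun q => g i q - g j q) 0 p := fun p hp => by
        simpa using! (hg i p hp.1).sub (hg j p hp.2)
      filter_upwards [(hopen.preimage continuous_subtype_val).mem_nhds hx] with y hy
      exact hopen.is_const_of_fderiv_eq_zero
        ((convex_ball _ _).inter (convex_ball _ _)).isPreconnected
        (fun p hp => (hd p hp).differentiableAt.differentiableWithinAt)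
        (fun p hp => (hd p hp).fderiv) hy hx)
  refine ⟨Function.extend Subtype.val f 0, fun p hp => ?_⟩
  have hlocal := hf ⟨p, hp⟩ ⟨p, hp⟩ (Metric.mem_ball_self (hr _))
  have hbase := (hg ⟨p, hp⟩ p (Metric.mem_ball_self (hr _))).const_add
    (f ⟨p, hp⟩ - g ⟨p, hp⟩ p)
  refine hbase.congr_of_eventuallyEq ?_
  rw [EventuallyEq, ← hU.isOpenEmbedding_subtypeVal.map_nhds_eq ⟨p, hp⟩, eventually_map]
  filter_upwards [hlocal] with y hy
  rw [Subtype.val_injective.extend_apply, ← hy, sub_add_cancel]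

section HeisenbergOperators

variable {U : Set (Fin 3 → ℝ)} {f g : (Fin 3 → ℝ) → ℝ} {p : Fin 3 → ℝ}

theorem opX_congr (hU : IsOpen U) (h : EqOn f g U) (hp : p ∈ U) : opX f p = opX g p := by
  rw [opX, opX, (h.eventuallyEq_of_mem (hU.mem_nhds hp)).fderiv_eq]

theorem opY_congr (hU : IsOpen U) (h : EqOn f g U) (hp : p ∈ U) : opY f p = opY g p := by
  rw [opY, opY, (h.eventuallyEq_of_mem (hU.mem_nhds hp)).fderiv_eq]

theorem opZ_congr (hU : IsOpen U) (h : EqOn f g U) (hp : p ∈ U) : opZ f p = opZ g p := by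
  rw [opZ, opZ, (h.eventuallyEq_of_mem (hU.mem_nhds hp)).fderiv_eq]

theorem hasFDerivAt_heisenbergField (p : Fin 3 → ℝ) :
    HasFDerivAt (fun p : Fin 3 → ℝ => ![0, p 0, 1])
      ((ContinuousLinearMap.proj 0 : (Fin 3 → ℝ) →L[ℝ] ℝ).smulRight ![0, 1, 0]) p := by
  have h : (fun p : Fin 3 → ℝ => ![0, p 0, 1]) =
      fun p => (ContinuousLinearMap.proj 0 : (Fin 3 → ℝ) →L[ℝ] ℝ).smulRight ![0, 1, 0] p +
        ![0, 0, 1] := by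
    ext p i
    fin_cases i <;> simp
  rw [h]
  exact (ContinuousLinearMap.hasFDerivAt _).add_const _

theorem fderiv_heisenbergField (p v : Fin 3 → ℝ) :
    fderiv ℝ (fun p : Fin 3 → ℝ => ![0, p 0, 1]) p v = v 0 • ![0, 1, 0] := by
  rw [(hasFDerivAt_heisenbergField p).fderiv]
  simp

theorem contDiff_heisenbergField : ContDiff ℝ (⊤ : ℕ∞) fun p : Fin 3 → ℝ => ![0, p 0, 1] := by
  rw [contDiff_pi]
  intro i
  fin_cases i <;> simp <;> fun_prop

theorem contDiffOn_opX (hU : IsOpen U) (hf : ContDiffOn ℝ (⊤ : ℕ∞) f U) :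
    ContDiffOn ℝ (⊤ : ℕ∞) (opX f) U :=
  ((contDiffOn_infty_iff_fderiv_of_isOpen hU).mp hf).2.clm_apply contDiffOn_const

theorem contDiffOn_opY (hU : IsOpen U) (hf : ContDiffOn ℝ (⊤ : ℕ∞) f U) :
    ContDiffOn ℝ (⊤ : ℕ∞) (opY f) U :=
  ((contDiffOn_infty_iff_fderiv_of_isOpen hU).mp hf).2.clm_apply
    contDiff_heisenbergField.contDiffOn

theorem contDiffOn_opZ (hU : IsOpen U) (hf : ContDiffOn ℝ (⊤ : ℕ∞) f U) :
    ContDiffOn ℝ (⊤ : ℕ∞) (opZ f) U :=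
  ((contDiffOn_infty_iff_fderiv_of_isOpen hU).mp hf).2.clm_apply contDiffOn_const

theorem ContDiffOn.differentiableAt_of_isOpen (hU : IsOpen U)
    (hf : ContDiffOn ℝ (⊤ : ℕ∞) f U) (hp : p ∈ U) : DifferentiableAt ℝ f p :=
  (hf.differentiableOn (by simp)).differentiableAt (hU.mem_nhds hp)

theorem opX_add (hf : DifferentiableAt ℝ f p) (hg : DifferentiableAt ℝ g p) :
    opX (f + g) p = opX f p + opX g p := by
  simp only [opX, fderiv_add hf hg, add_apply]

theorem opX_sub (hf : DifferentiableAt ℝ f p) (hg : DifferentiableAt ℝ g p) :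
    opX (f - g) p = opX f p - opX g p := by
  simp only [opX, fderiv_sub hf hg, sub_apply]

theorem opY_sub (hf : DifferentiableAt ℝ f p) (hg : DifferentiableAt ℝ g p) :
    opY (f - g) p = opY f p - opY g p := by
  simp only [opY, fderiv_sub hf hg, sub_apply]

theorem fderiv_fderiv_apply_field {W : (Fin 3 → ℝ) → Fin 3 → ℝ} (hU : IsOpen U)
    (hf : ContDiffOn ℝ (⊤ : ℕ∞) f U) (hW : DifferentiableAt ℝ W p) (hp : p ∈ U)
    (v : Fin 3 → ℝ) :
    fderiv ℝ (fun q => fderiv ℝ f q (W q)) p v =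
      fderiv ℝ f p (fderiv ℝ W p v) + fderiv ℝ (fderiv ℝ f) p v (W p) := by
  have h : DifferentiableAt ℝ (fderiv ℝ f) p :=
    (((contDiffOn_infty_iff_fderiv_of_isOpen hU).mp hf).2.differentiableOn
      (by simp)).differentiableAt (hU.mem_nhds hp)
  rw [fderiv_clm_apply h hW]
  simp

theorem fderiv_fderiv_symm (hU : IsOpen U) (hf : ContDiffOn ℝ (⊤ : ℕ∞) f U) (hp : p ∈ U)
    (u v : Fin 3 → ℝ) :
    fderiv ℝ (fderiv ℝ f) p u v = fderiv ℝ (fderiv ℝ f) p v u :=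
  (hf.contDiffAt (hU.mem_nhds hp)).isSymmSndFDerivAt
    (by rw [minSmoothness_of_isRCLikeNormedField]; exact WithTop.coe_le_coe.mpr le_top) u v

/-- The bracket relation `[X, Y] = Z`. -/
theorem opX_opY_sub_opY_opX (hU : IsOpen U) (hf : ContDiffOn ℝ (⊤ : ℕ∞) f U) (hp : p ∈ U) :
    opX (opY f) p - opY (opX f) p = opZ f p := by
  unfold opX opY opZ
  rw [fderiv_fderiv_apply_field hU hf
      (hasFDerivAt_heisenbergField p).differentiableAt hp,
    fderiv_fderiv_apply_field hU hf (differentiableAt_const _) hp, fderiv_heisenbergField,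
    fderiv_fderiv_symm hU hf hp ![0, p 0, 1]]
  simp

theorem opX_opZ (hU : IsOpen U) (hf : ContDiffOn ℝ (⊤ : ℕ∞) f U) (hp : p ∈ U) :
    opX (opZ f) p = opZ (opX f) p := by
  unfold opX opZ
  rw [fderiv_fderiv_apply_field hU hf (differentiableAt_const _) hp,
    fderiv_fderiv_apply_field hU hf (differentiableAt_const _) hp,
    fderiv_fderiv_symm hU hf hp ![0, 1, 0]]
  simp

theorem opY_opZ (hU : IsOpen U) (hf : ContDiffOn ℝ (⊤ : ℕ∞) f U) (hp : p ∈ U) :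
    opY (opZ f) p = opZ (opY f) p := by
  unfold opY opZ
  rw [fderiv_fderiv_apply_field hU hf (differentiableAt_const _) hp,
    fderiv_fderiv_apply_field hU hf
      (hasFDerivAt_heisenbergField p).differentiableAt hp,
    fderiv_heisenbergField, fderiv_fderiv_symm hU hf hp ![0, 1, 0]]
  simp

theorem clm_apply_fin_three (L : (Fin 3 → ℝ) →L[ℝ] ℝ) (u : Fin 3 → ℝ) :
    L u = u 0 * L ![1, 0, 0] + u 1 * L ![0, 1, 0] + u 2 * L ![0, 0, 1] := by
  have h : u = u 0 • ![1, 0, 0] + u 1 • ![0, 1, 0] + u 2 • ![0, 0, 1] := by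
    ext i
    fin_cases i <;> simp
  conv_lhs => rw [h]
  simp only [map_add, map_smul, smul_eq_mul]

theorem opY_eq (f : (Fin 3 → ℝ) → ℝ) (p : Fin 3 → ℝ) :
    opY f p = p 0 * opZ f p + fderiv ℝ f p ![0, 0, 1] := by
  rw [opY, clm_apply_fin_three]
  simp [opZ]

/-- The 1-form `a dx + c dy + (b - x c) dt`, which takes the values `a`, `b`, `c` on the fields
`X`, `Y`, `Z`. -/
noncomputable def heisenbergForm (a b c : (Fin 3 → ℝ) → ℝ) (p : Fin 3 → ℝ) :
    (Fin 3 → ℝ) →L[ℝ] ℝ :=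
  a p • ContinuousLinearMap.proj 0 + c p • ContinuousLinearMap.proj 1 +
    (b p - p 0 * c p) • ContinuousLinearMap.proj 2

variable {a b c : (Fin 3 → ℝ) → ℝ}

theorem contDiffOn_heisenbergForm (ha : ContDiffOn ℝ (⊤ : ℕ∞) a U)
    (hb : ContDiffOn ℝ (⊤ : ℕ∞) b U) (hc : ContDiffOn ℝ (⊤ : ℕ∞) c U) :
    ContDiffOn ℝ (⊤ : ℕ∞) (heisenbergForm a b c) U := by
  have hx : ContDiffOn ℝ (⊤ : ℕ∞) (fun p : Fin 3 → ℝ => p 0) U := by fun_prop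
  exact ((ha.smul contDiffOn_const).add (hc.smul contDiffOn_const)).add
    ((hb.sub (hx.mul hc)).smul contDiffOn_const)

theorem fderiv_heisenbergForm_apply (ha : DifferentiableAt ℝ a p) (hb : DifferentiableAt ℝ b p)
    (hc : DifferentiableAt ℝ c p) (u v : Fin 3 → ℝ) :
    fderiv ℝ (heisenbergForm a b c) p u v =
      fderiv ℝ a p u * v 0 + fderiv ℝ c p u * v 1 +
        (fderiv ℝ b p u - (p 0 * fderiv ℝ c p u + c p * u 0)) * v 2 := by
  have hx : HasFDerivAt (fun p : Fin 3 → ℝ => p 0) (ContinuousLinearMap.proj 0) p :=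
    (ContinuousLinearMap.proj 0 : (Fin 3 → ℝ) →L[ℝ] ℝ).hasFDerivAt
  have h := ((ha.hasFDerivAt.smul_const (ContinuousLinearMap.proj 0 : (Fin 3 → ℝ) →L[ℝ] ℝ)).add
    (hc.hasFDerivAt.smul_const (ContinuousLinearMap.proj 1 : (Fin 3 → ℝ) →L[ℝ] ℝ))).add
    ((hb.hasFDerivAt.sub (hx.mul hc.hasFDerivAt)).smul_const
      (ContinuousLinearMap.proj 2 : (Fin 3 → ℝ) →L[ℝ] ℝ))
  have h' : HasFDerivAt (heisenbergForm a b c) _ p := h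
  rw [h'.fderiv]
  simp

theorem fderiv_heisenbergForm_symm (ha : DifferentiableAt ℝ a p) (hb : DifferentiableAt ℝ b p)
    (hc : DifferentiableAt ℝ c p) (hZ : opX b p - opY a p = c p) (hX : opX c p = opZ a p)
    (hY : opY c p = opZ b p) (u v : Fin 3 → ℝ) :
    fderiv ℝ (heisenbergForm a b c) p u v = fderiv ℝ (heisenbergForm a b c) p v u := by
  rw [fderiv_heisenbergForm_apply ha hb hc, fderiv_heisenbergForm_apply ha hb hc]
  rw [opY_eq] at hZ hY
  simp only [opX, opZ] at hZ hX hY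
  simp only [clm_apply_fin_three (fderiv ℝ _ p) u, clm_apply_fin_three (fderiv ℝ _ p) v]
  linear_combination (u 0 * v 1 - v 0 * u 1) * hX + (u 0 * v 2 - u 2 * v 0) * hZ
    - (p 0) * (u 0 * v 2 - u 2 * v 0) * hX + (u 2 * v 1 - u 1 * v 2) * hY

end HeisenbergOperators

theorem heisenberg_rumin_integrability
    (U : Set (Fin 3 → ℝ)) (hU : IsOpen U) (hUc : ContractibleSpace U)
    (a b : (Fin 3 → ℝ) → ℝ)
    (ha : ContDiffOn ℝ (⊤ : ℕ∞) a U) (hb : ContDiffOn ℝ (⊤ : ℕ∞) b U) :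
    (∀ p ∈ U, opX (opX b) p = opX (opY a) p + opZ a p ∧
              opY (opY a) p = opY (opX b) p - opZ b p) ↔
    (∃ f : (Fin 3 → ℝ) → ℝ, ContDiffOn ℝ (⊤ : ℕ∞) f U ∧
      ∀ p ∈ U, opX f p = a p ∧ opY f p = b p) := by
  have : SimplyConnectedSpace U := inferInstance
  constructor
  · intro h
    have hXb := contDiffOn_opX hU hb
    have hYa := contDiffOn_opY hU ha
    have hc : ContDiffOn ℝ (⊤ : ℕ∞) (opX b - opY a) U := hXb.sub hYa
    have hω := contDiffOn_heisenbergForm ha hb hc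
    obtain ⟨f, hf⟩ := hU.exists_forall_hasFDerivAt_of_simplyConnected
      (hω.differentiableOn (by simp)) fun p hp =>
        fderiv_heisenbergForm_symm (ha.differentiableAt_of_isOpen hU hp)
          (hb.differentiableAt_of_isOpen hU hp) (hc.differentiableAt_of_isOpen hU hp) rfl
          (by
            rw [opX_sub (hXb.differentiableAt_of_isOpen hU hp)
              (hYa.differentiableAt_of_isOpen hU hp), (h p hp).1, add_sub_cancel_left])
          (by
            rw [opY_sub (hXb.differentiableAt_of_isOpen hU hp)
              (hYa.differentiableAt_of_isOpen hU hp), (h p hp).2, sub_sub_cancel])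
    refine ⟨f, (contDiffOn_infty_iff_fderiv_of_isOpen hU).mpr
      ⟨fun p hp => (hf p hp).differentiableAt.differentiableWithinAt,
        hω.congr fun p hp => (hf p hp).fderiv⟩, fun p hp => ?_⟩
    simp only [opX, opY, (hf p hp).fderiv]
    refine ⟨by simp [heisenbergForm], ?_⟩
    simp [heisenbergForm]
    ring
  · rintro ⟨f, hf, h⟩ p hp
    have hX : EqOn (opX f) a U := fun q hq => (h q hq).1
    have hY : EqOn (opY f) b U := fun q hq => (h q hq).2
    have hZf := contDiffOn_opZ hU hf
    have hbracket : ∀ q ∈ U, opX b q - opY a q = opZ f q := fun q hq => by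
      rw [← opX_congr hU hY hq, ← opY_congr hU hX hq, opX_opY_sub_opY_opX hU hf hq]
    have hXb : EqOn (opX b) (opY a + opZ f) U := fun q hq => by
      simp [← hbracket q hq]
    have hYa : EqOn (opY a) (opX b - opZ f) U := fun q hq => by
      simp [← hbracket q hq]
    have hZd := hZf.differentiableAt_of_isOpen hU hp
    constructor
    · rw [opX_congr hU hXb hp, opX_add ((contDiffOn_opY hU ha).differentiableAt_of_isOpen hU hp) hZd,
        opX_opZ hU hf hp, opZ_congr hU hX hp]
    · rw [opY_congr hU hYa hp, opY_sub ((contDiffOn_opX hU hb).differentiableAt_of_isOpen hU hp) hZd,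
        opY_opZ hU hf hp, opZ_congr hU hY hp]
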